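/- Uniform convergence of the discrete singular component: there exist constants C₀ > 0 and C, depending only on a, T, α and |w(0)| but not on ε or N, such that for every ε ∈ (0,1], every N ≥ 1, and every mesh 0 = t_0 < ... < t_N = T with h_j ≤ C₀ N⁻¹ for all j, the mesh function W : {0,...,N} → ℝ defined by W_0 = w(0) and ε σ_j (W_j − W_{j−1})/h_j + a(t_j) W_j = 0 for 1 ≤ j ≤ N satisfies max_{0 ≤ j ≤ N} |W_j − w(t_j)| ≤ C N⁻¹, where w is the singular component. -/

import Mathlib

open Set

/-- A function continuous on `[0, T]` has a primitive there that vanishes at `0`, with two-sided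
derivatives at the endpoints. -/
theorem exists_primitive_Icc {T : ℝ} (hT : 0 ≤ T) {a : ℝ → ℝ} (ha : ContinuousOn a (Icc 0 T)) :
    ∃ A : ℝ → ℝ, A 0 = 0 ∧ ∀ t ∈ Icc (0:ℝ) T, HasDerivAt A (a t) t := by
  have hb : Continuous (IccExtend hT ((Icc 0 T).domRestrict a)) :=
    (continuousOn_iff_continuous_domRestrict.mp ha).Icc_extend'
  refine ⟨fun t => ∫ x in (0:ℝ)..t, IccExtend hT ((Icc 0 T).domRestrict a) x,
    intervalIntegral.integral_same, fun t ht => ?_⟩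
  have h := hb.integral_hasStrictDerivAt 0 t
  rw [IccExtend_of_mem hT _ ht] at h
  exact h.hasDerivAt

/-- The mean value theorem for a primitive on a subinterval of `[0, T]`. -/
theorem exists_primitive_sub_eq {T : ℝ} {a A : ℝ → ℝ}
    (hA : ∀ t ∈ Icc (0:ℝ) T, HasDerivAt A (a t) t) {s t : ℝ} (hs : 0 ≤ s) (hst : s < t)
    (ht : t ≤ T) : ∃ c ∈ Ioo s t, A t - A s = a c * (t - s) := by
  have hmem : ∀ x ∈ Icc s t, x ∈ Icc (0:ℝ) T := fun x hx => ⟨hs.trans hx.1, hx.2.trans ht⟩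
  obtain ⟨c, hc, h⟩ := exists_hasDerivAt_eq_slope A a hst
    (fun x hx => (hA x (hmem x hx)).continuousAt.continuousWithinAt)
    (fun x hx => hA x (hmem x (Ioo_subset_Icc_self hx)))
  exact ⟨c, hc, by rw [h, div_mul_cancel₀ _ (sub_pos.mpr hst).ne']⟩

/-- The solution of `ε w' + a w = 0` is `w 0 * exp (-A / ε)`, where `A` is the primitive of `a`
that vanishes at `0`. -/
theorem eq_mul_exp_neg_primitive_div {T ε : ℝ} (hε : 0 < ε) {a A w w' : ℝ → ℝ}
    (hA0 : A 0 = 0) (hA : ∀ t ∈ Icc (0:ℝ) T, HasDerivAt A (a t) t)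
    (hw : ∀ t ∈ Icc (0:ℝ) T, HasDerivAt w (w' t) t)
    (hode : ∀ t ∈ Icc (0:ℝ) T, ε * w' t + a t * w t = 0) {t : ℝ} (ht : t ∈ Icc (0:ℝ) T) :
    w t = w 0 * Real.exp (-(A t / ε)) := by
  have hg : ∀ x ∈ Icc (0:ℝ) T, HasDerivAt (fun y => w y * Real.exp (A y / ε)) 0 x := by
    intro x hx
    refine ((hw x hx).mul ((hA x hx).div_const ε).exp).congr_deriv ?_
    have hw' : w' x = -(a x * w x) / ε := by
      rw [eq_div_iff hε.ne']
      linarith [hode x hx]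
    rw [hw']
    ring
  have h := constant_of_has_deriv_right_zero
    (fun x hx => (hg x hx).continuousAt.continuousWithinAt)
    (fun x hx => (hg x (Ico_subset_Icc_self hx)).hasDerivWithinAt) t ht
  simp only [hA0, zero_div, Real.exp_zero, mul_one] at h
  rw [← h, mul_assoc, ← Real.exp_add, add_neg_cancel, Real.exp_zero, mul_one]

/-- `x ↦ exp (-x)` is Lipschitz on `[m, ∞)` with constant `exp (-m)`. -/
theorem abs_exp_neg_sub_exp_neg_le {m x y : ℝ} (hx : m ≤ x) (hy : m ≤ y) :
    |Real.exp (-x) - Real.exp (-y)| ≤ |x - y| * Real.exp (-m) := by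
  wlog hxy : x ≤ y generalizing x y
  · rw [abs_sub_comm, abs_sub_comm x y]
    exact this hy hx (le_of_not_ge hxy)
  rw [abs_of_nonneg (sub_nonneg.mpr (Real.exp_le_exp.mpr (neg_le_neg hxy))), abs_sub_comm,
    abs_of_nonneg (sub_nonneg.mpr hxy)]
  have hsplit : Real.exp (-y) = Real.exp (-x) * Real.exp (x - y) := by
    rw [← Real.exp_add]
    congr 1
    ring
  calc Real.exp (-x) - Real.exp (-y) = (1 - Real.exp (x - y)) * Real.exp (-x) := by
        rw [hsplit]; ring
    _ ≤ (y - x) * Real.exp (-x) := by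
        refine mul_le_mul_of_nonneg_right ?_ (Real.exp_pos _).le
        linarith [Real.add_one_le_exp (x - y)]
    _ ≤ (y - x) * Real.exp (-m) :=
        mul_le_mul_of_nonneg_left (Real.exp_le_exp.mpr (neg_le_neg hx)) (sub_nonneg.mpr hxy)

/-- One step of the exponentially fitted scheme is multiplication by `exp (-b h / ε)`. -/
theorem eq_mul_exp_of_fitted_step {ε b h u v : ℝ} (hε : 0 < ε) (hb : 0 < b) (hh : 0 < h)
    (hstep : ε * (b * (h / ε) / (Real.exp (b * (h / ε)) - 1)) * (v - u) / h + b * v = 0) :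
    v = u * Real.exp (-(b * h / ε)) := by
  have hE : 0 < Real.exp (b * (h / ε)) - 1 := sub_pos.mpr (Real.one_lt_exp_iff.mpr (by positivity))
  rw [← mul_div_assoc b h ε] at hstep hE
  set E := Real.exp (b * h / ε) with hE_def
  have hcoef : ε * (b * h / ε / (E - 1)) * (v - u) / h = b * (v - u) / (E - 1) := by
    field_simp
  rw [hcoef, div_add' _ _ _ hE.ne', div_eq_zero_iff, or_iff_left hE.ne'] at hstep
  have hu : u = v * E := by
    have : b * (v * E - u) = 0 := by linear_combination hstep
    linarith [(mul_eq_zero.mp this).resolve_left hb.ne']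
  rw [hu, hE_def, mul_assoc, ← Real.exp_add, add_neg_cancel, Real.exp_zero, mul_one]

/-- The mesh function generated by the fitted scheme is `w0 * exp (-S / ε)`, where `S` is a
right-endpoint Riemann sum of `a`, which is close to the primitive `A`. -/
theorem exists_fitted_eq_mul_exp {T α L H ε w0 : ℝ} (hα : 0 < α) (hε : 0 < ε)
    {a A : ℝ → ℝ} (hA0 : A 0 = 0) (hA : ∀ t ∈ Icc (0:ℝ) T, HasDerivAt A (a t) t)
    (ha : ∀ t ∈ Icc (0:ℝ) T, α ≤ a t)
    (hL : 0 ≤ L) (hLip : ∀ x ∈ Icc (0:ℝ) T, ∀ y ∈ Icc (0:ℝ) T, |a x - a y| ≤ L * |x - y|)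
    {N : ℕ} {t : ℕ → ℝ} (ht0 : t 0 = 0) (hmem : ∀ j ≤ N, t j ∈ Icc (0:ℝ) T)
    (hlt : ∀ j : ℕ, 1 ≤ j → j ≤ N → t (j - 1) < t j)
    (hH : ∀ j : ℕ, 1 ≤ j → j ≤ N → t j - t (j - 1) ≤ H)
    {W : ℕ → ℝ} (hW0 : W 0 = w0)
    (hW : ∀ j : ℕ, 1 ≤ j → j ≤ N →
      ε * (a (t j) * ((t j - t (j - 1)) / ε) /
            (Real.exp (a (t j) * ((t j - t (j - 1)) / ε)) - 1)) *
          (W j - W (j - 1)) / (t j - t (j - 1)) + a (t j) * W j = 0)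
    {j : ℕ} (hj : j ≤ N) :
    ∃ S : ℝ, W j = w0 * Real.exp (-(S / ε)) ∧ α * t j ≤ S ∧ α * t j ≤ A (t j) ∧
      |S - A (t j)| ≤ L * H * t j := by
  induction j with
  | zero => exact ⟨0, by simp [ht0, hA0, hW0]⟩
  | succ k ih =>
    obtain ⟨S, hS, hαS, hαA, hSA⟩ := ih (by omega)
    have hlt' := hlt (k + 1) (by omega) hj
    have hH' := hH (k + 1) (by omega) hj
    have hW' := hW (k + 1) (by omega) hj
    rw [Nat.add_sub_cancel] at hlt' hH' hW'
    have hm := hmem (k + 1) hj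
    have hk := hmem k (by omega)
    have hh : 0 < t (k + 1) - t k := sub_pos.mpr hlt'
    have hstep := eq_mul_exp_of_fitted_step hε (hα.trans_le (ha _ hm)) hh hW'
    obtain ⟨c, hc, hAc⟩ := exists_primitive_sub_eq hA hk.1 hlt' hm.2
    have hcT : c ∈ Icc (0:ℝ) T := ⟨hk.1.trans hc.1.le, hc.2.le.trans hm.2⟩
    refine ⟨S + a (t (k + 1)) * (t (k + 1) - t k), ?_, ?_, ?_, ?_⟩
    · rw [hstep, hS, mul_assoc, ← Real.exp_add]
      congr 2
      ring
    · linarith [mul_le_mul_of_nonneg_right (ha _ hm) hh.le]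
    · linarith [mul_le_mul_of_nonneg_right (ha _ hcT) hh.le]
    · have hac : |a (t (k + 1)) - a c| ≤ L * H := by
        refine (hLip _ hm _ hcT).trans (mul_le_mul_of_nonneg_left ?_ hL)
        rw [abs_of_pos (sub_pos.mpr hc.2)]
        linarith [hc.1]
      calc |S + a (t (k + 1)) * (t (k + 1) - t k) - A (t (k + 1))|
          = |(S - A (t k)) + (a (t (k + 1)) - a c) * (t (k + 1) - t k)| := by
            congr 1
            linear_combination -hAc
        _ ≤ |S - A (t k)| + |a (t (k + 1)) - a c| * (t (k + 1) - t k) := by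
            refine (abs_add_le _ _).trans_eq ?_
            rw [abs_mul, abs_of_pos hh]
        _ ≤ L * H * t k + L * H * (t (k + 1) - t k) := by gcongr
        _ = L * H * t (k + 1) := by ring

/-- A differentiable function with continuous derivative on `[0, T]` is Lipschitz there. -/
theorem exists_lipschitz_bound_Icc {T : ℝ} {a a' : ℝ → ℝ}
    (ha : ∀ t ∈ Icc (0:ℝ) T, HasDerivAt a (a' t) t) (ha' : ContinuousOn a' (Icc 0 T)) :
    ∃ L : ℝ, 0 ≤ L ∧
      ∀ x ∈ Icc (0:ℝ) T, ∀ y ∈ Icc (0:ℝ) T, |a x - a y| ≤ L * |x - y| := by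
  obtain ⟨L, hL⟩ := isCompact_Icc.exists_bound_of_continuousOn ha'
  refine ⟨max L 0, le_max_right _ _, fun x hx y hy => ?_⟩
  exact (convex_Icc (0:ℝ) T).norm_image_sub_le_of_norm_hasDerivWithin_le
    (fun z hz => (ha z hz).hasDerivWithinAt) (fun z hz => (hL z hz).trans (le_max_left _ _)) hy hx

/-- If two exponents are at least `α s / ε` and differ by at most `K s / ε`, then the exponentials
differ by at most `K / α`, uniformly in `s` and `ε`. -/
theorem abs_exp_neg_div_sub_le {α ε K s S A : ℝ} (hα : 0 < α) (hε : 0 < ε) (hK : 0 ≤ K)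
    (hS : α * s ≤ S) (hA : α * s ≤ A) (hSA : |S - A| ≤ K * s) :
    |Real.exp (-(S / ε)) - Real.exp (-(A / ε))| ≤ K / α := by
  have h := abs_exp_neg_sub_exp_neg_le (m := α * s / ε) (x := S / ε) (y := A / ε)
    (by gcongr) (by gcongr)
  calc |Real.exp (-(S / ε)) - Real.exp (-(A / ε))|
      ≤ |S / ε - A / ε| * Real.exp (-(α * s / ε)) := h
    _ = |S - A| / ε * Real.exp (-(α * s / ε)) := by
        rw [← sub_div, abs_div, abs_of_pos hε]
    _ ≤ K * s / ε * Real.exp (-(α * s / ε)) := by gcongr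
    _ = K / α * (α * s / ε * Real.exp (-(α * s / ε))) := by field_simp
    _ ≤ K / α * 1 := by
        gcongr
        rw [Real.exp_neg, ← div_eq_mul_inv, div_le_one (Real.exp_pos _)]
        linarith [Real.add_one_le_exp (α * s / ε)]
    _ = K / α := mul_one _

/-- A strictly increasing mesh from `0` to `T` stays in `[0, T]`. -/
theorem mesh_mem_Icc {T : ℝ} {N : ℕ} {t : ℕ → ℝ} (ht0 : t 0 = 0) (htN : t N = T)
    (hlt : ∀ j : ℕ, 1 ≤ j → j ≤ N → t (j - 1) < t j) : ∀ j ≤ N, t j ∈ Icc (0:ℝ) T := by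
  have hmono : MonotoneOn t (Iic N) := by
    refine monotoneOn_of_le_succ ordConnected_Iic fun k _ _ hk => ?_
    exact (hlt (k + 1) (by omega) hk).le
  intro j hj
  rw [← ht0, ← htN]
  exact ⟨hmono (Nat.zero_le N) hj (Nat.zero_le j), hmono hj (le_refl N) hj⟩

/-- Uniform convergence of the discrete singular component on meshes with `h_j ≤ C₀ / N`, for an
arbitrary mesh constant `C₀`. -/
theorem exists_uniform_error_bound (C₀ : ℝ) (hC₀ : 0 < C₀)
    (T α w0 : ℝ) (hT : 0 < T) (hα : 0 < α) (hw0 : 0 ≤ w0)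
    (a a' : ℝ → ℝ)
    (ha_deriv : ∀ t ∈ Set.Icc (0:ℝ) T, HasDerivAt a (a' t) t)
    (ha'_cont : ContinuousOn a' (Set.Icc 0 T))
    (ha : ∀ t ∈ Set.Icc (0:ℝ) T, α ≤ a t) :
    ∃ C : ℝ, ∀ ε ∈ Set.Ioc (0:ℝ) 1, ∀ w w' : ℝ → ℝ,
      (∀ t ∈ Set.Icc (0:ℝ) T, HasDerivAt w (w' t) t) →
      (∀ t ∈ Set.Icc (0:ℝ) T, ε * w' t + a t * w t = 0) →
      w 0 = w0 →
      ∀ (N : ℕ), 1 ≤ N → ∀ t : ℕ → ℝ,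
        t 0 = 0 → t N = T → (∀ j : ℕ, 1 ≤ j → j ≤ N → t (j - 1) < t j) →
        (∀ j : ℕ, 1 ≤ j → j ≤ N → t j - t (j - 1) ≤ C₀ * (N : ℝ)⁻¹) →
        ∀ W : ℕ → ℝ, W 0 = w0 →
        (∀ j : ℕ, 1 ≤ j → j ≤ N →
          ε * (a (t j) * ((t j - t (j - 1)) / ε) /
                (Real.exp (a (t j) * ((t j - t (j - 1)) / ε)) - 1)) *
              (W j - W (j - 1)) / (t j - t (j - 1)) + a (t j) * W j = 0) →
        ∀ j : ℕ, j ≤ N → |W j - w (t j)| ≤ C * (N : ℝ)⁻¹ := by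
  obtain ⟨L, hL, hLip⟩ := exists_lipschitz_bound_Icc ha_deriv ha'_cont
  obtain ⟨A, hA0, hA⟩ := exists_primitive_Icc hT.le
    (fun t ht => (ha_deriv t ht).continuousAt.continuousWithinAt)
  refine ⟨w0 * (L * C₀ / α), ?_⟩
  intro ε hε w w' hw hode hw_zero N _ t ht0 htN hlt hH W hW0 hW j hj
  have hmem := mesh_mem_Icc ht0 htN hlt
  obtain ⟨S, hS, hαS, hαA, hSA⟩ := exists_fitted_eq_mul_exp hα hε.1 hA0 hA ha hL hLip ht0 hmem
    hlt hH hW0 hW hj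
  rw [hS, eq_mul_exp_neg_primitive_div hε.1 hA0 hA hw hode (hmem j hj), hw_zero, ← mul_sub,
    abs_mul, abs_of_nonneg hw0]
  calc w0 * |Real.exp (-(S / ε)) - Real.exp (-(A (t j) / ε))|
      ≤ w0 * (L * (C₀ * (N : ℝ)⁻¹) / α) :=
        mul_le_mul_of_nonneg_left
          (abs_exp_neg_div_sub_le hα hε.1 (by positivity) hαS hαA hSA) hw0
    _ = w0 * (L * C₀ / α) * (N : ℝ)⁻¹ := by ring

/-- Parameter-uniform first-order convergence of the discrete singular component. -/
theorem uniform_convergence_singular_component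
    (T α w0 : ℝ) (hT : 0 < T) (hα : 0 < α) (hw0 : 0 ≤ w0)
    (a a' : ℝ → ℝ)
    (ha_deriv : ∀ t ∈ Set.Icc (0:ℝ) T, HasDerivAt a (a' t) t)
    (ha'_cont : ContinuousOn a' (Set.Icc 0 T))
    (ha : ∀ t ∈ Set.Icc (0:ℝ) T, α ≤ a t) :
    ∃ C₀ : ℝ, 0 < C₀ ∧ ∃ C : ℝ, ∀ ε ∈ Set.Ioc (0:ℝ) 1, ∀ w w' : ℝ → ℝ,
      (∀ t ∈ Set.Icc (0:ℝ) T, HasDerivAt w (w' t) t) →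
      (∀ t ∈ Set.Icc (0:ℝ) T, ε * w' t + a t * w t = 0) →
      w 0 = w0 →
      ∀ (N : ℕ), 1 ≤ N → ∀ t : ℕ → ℝ,
        t 0 = 0 → t N = T → (∀ j : ℕ, 1 ≤ j → j ≤ N → t (j - 1) < t j) →
        (∀ j : ℕ, 1 ≤ j → j ≤ N → t j - t (j - 1) ≤ C₀ * (N : ℝ)⁻¹) →
        ∀ W : ℕ → ℝ, W 0 = w0 →
        (∀ j : ℕ, 1 ≤ j → j ≤ N →
          ε * (a (t j) * ((t j - t (j - 1)) / ε) /
                (Real.exp (a (t j) * ((t j - t (j - 1)) / ε)) - 1)) *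
              (W j - W (j - 1)) / (t j - t (j - 1)) + a (t j) * W j = 0) →
        ∀ j : ℕ, j ≤ N → |W j - w (t j)| ≤ C * (N : ℝ)⁻¹ := by
  exact ⟨2 * T, by positivity,
    exists_uniform_error_bound (2 * T) (by positivity) T α w0 hT hα hw0 a a' ha_deriv ha'_cont ha⟩
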